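/- The map β : B → B defined by β(Σ_i a_i X^i) = Σ_i *^{i+1}(a_i) X^i is an involution of B = A[X;*]^fl extending the involution * of A; that is, β is K-linear, β(β(p)) = p and β(pq) = β(q)β(p) for all p, q ∈ B, and β(a) = a* for all a ∈ A. -/

import Mathlib

/-- `tau n a b = ab` if `n` is even and `ba` if `n` is odd. -/
def tau {A : Type*} [NonAssocRing A] (n : ℕ) (a b : A) : A :=
  if Even n then a * b else b * a

/-- The `m`-fold iterate `*^m` of the involution `*`. -/
def starIter {A : Type*} [NonAssocRing A] [StarRing A] : ℕ → A → A
  | 0, a => a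
  | m+1, a => star (starIter m a)

/-- The multiplication of the flipped non-associative skew polynomial ring `B = A[X;*]^fl`:
the biadditive extension of `(aX^m)(bX^n) = τ_n(a, *^m(b)) X^{m+n}`. Polynomials are
represented as finitely supported functions `ℕ →₀ A`. -/
noncomputable def fmul {A : Type*} [NonAssocRing A] [StarRing A] (p q : ℕ →₀ A) : ℕ →₀ A :=
  p.sum fun m a => q.sum fun n b => Finsupp.single (m+n) (tau n a (starIter m b))

/-- The map `α : B → B`, `α(Σ_i a_i X^i) = Σ_i (−1)^i *^{i+1}(a_i) X^i`. -/
noncomputable def alphaMap {A : Type*} [NonAssocRing A] [StarRing A] (p : ℕ →₀ A) : ℕ →₀ A :=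
  p.sum fun i a => Finsupp.single i ((-1 : ℤ) ^ i • starIter (i+1) a)

/-- The map `β : B → B`, `β(Σ_i a_i X^i) = Σ_i *^{i+1}(a_i) X^i`. -/
noncomputable def betaMap {A : Type*} [NonAssocRing A] [StarRing A] (p : ℕ →₀ A) : ℕ →₀ A :=
  p.sum fun i a => Finsupp.single i (starIter (i+1) a)

theorem starIter_eq_ite {A : Type*} [NonAssocRing A] [StarRing A] (n : ℕ) (a : A) :
    starIter n a = if Even n then a else star a := by
  induction n with
  | zero => simp [starIter]
  | succ n ih =>
    by_cases h : Even n <;> simp [starIter, ih, h, Nat.even_add_one]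

@[simp]
theorem starIter_zero {A : Type*} [NonAssocRing A] [StarRing A] (n : ℕ) :
    starIter n (0 : A) = 0 := by
  simp [starIter_eq_ite]

theorem starIter_add {A : Type*} [NonAssocRing A] [StarRing A] (n : ℕ) (a b : A) :
    starIter n (a + b) = starIter n a + starIter n b := by
  by_cases h : Even n <;> simp [starIter_eq_ite, h]

theorem starIter_starIter {A : Type*} [NonAssocRing A] [StarRing A] (n : ℕ) (a : A) :
    starIter n (starIter n a) = a := by
  by_cases h : Even n <;> simp [starIter_eq_ite, h]

theorem starIter_tau {A : Type*} [NonAssocRing A] [StarRing A] (m n : ℕ) (a b : A) :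
    starIter (m + n + 1) (tau n a (starIter m b)) =
      tau m (starIter (n + 1) b) (starIter n (starIter (m + 1) a)) := by
  by_cases hm : Even m <;> by_cases hn : Even n <;>
    simp [starIter_eq_ite, tau, hm, hn, Nat.even_add, Nat.even_add_one]

@[simp]
theorem tau_zero_left {A : Type*} [NonAssocRing A] (n : ℕ) (b : A) : tau n 0 b = 0 := by
  simp [tau]

@[simp]
theorem tau_zero_right {A : Type*} [NonAssocRing A] (n : ℕ) (a : A) : tau n a 0 = 0 := by
  simp [tau]

theorem tau_add_left {A : Type*} [NonAssocRing A] (n : ℕ) (a a' b : A) :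
    tau n (a + a') b = tau n a b + tau n a' b := by
  by_cases h : Even n <;> simp [tau, h, add_mul, mul_add]

theorem tau_add_right {A : Type*} [NonAssocRing A] (n : ℕ) (a b b' : A) :
    tau n a (b + b') = tau n a b + tau n a b' := by
  by_cases h : Even n <;> simp [tau, h, add_mul, mul_add]

@[simp]
theorem betaMap_zero {A : Type*} [NonAssocRing A] [StarRing A] :
    betaMap (0 : ℕ →₀ A) = 0 := by
  simp [betaMap]

theorem betaMap_single {A : Type*} [NonAssocRing A] [StarRing A] (i : ℕ) (a : A) :
    betaMap (Finsupp.single i a) = Finsupp.single i (starIter (i + 1) a) := by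
  simp [betaMap]

theorem betaMap_add {A : Type*} [NonAssocRing A] [StarRing A] (p q : ℕ →₀ A) :
    betaMap (p + q) = betaMap p + betaMap q :=
  Finsupp.sum_add_index' (by simp) (by simp [starIter_add])

@[simp]
theorem fmul_zero_left {A : Type*} [NonAssocRing A] [StarRing A] (q : ℕ →₀ A) :
    fmul 0 q = 0 := by
  simp [fmul]

@[simp]
theorem fmul_zero_right {A : Type*} [NonAssocRing A] [StarRing A] (p : ℕ →₀ A) :
    fmul p 0 = 0 := by
  simp [fmul]

theorem fmul_single_single {A : Type*} [NonAssocRing A] [StarRing A] (m n : ℕ) (a b : A) :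
    fmul (Finsupp.single m a) (Finsupp.single n b) =
      Finsupp.single (m + n) (tau n a (starIter m b)) := by
  simp [fmul]

theorem fmul_add_left {A : Type*} [NonAssocRing A] [StarRing A] (p p' q : ℕ →₀ A) :
    fmul (p + p') q = fmul p q + fmul p' q :=
  Finsupp.sum_add_index' (by simp) (by simp [tau_add_left])

theorem fmul_add_right {A : Type*} [NonAssocRing A] [StarRing A] (p q q' : ℕ →₀ A) :
    fmul p (q + q') = fmul p q + fmul p q' := by
  simp only [fmul]
  rw [← Finsupp.sum_add]
  refine Finsupp.sum_congr fun m _ => ?_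
  exact Finsupp.sum_add_index' (by simp) (by simp [starIter_add, tau_add_right])

theorem betaMap_smul {K A : Type*} [CommRing K] [NonAssocRing A] [Module K A] [StarRing A]
    (hstar : ∀ (k : K) (a : A), star (k • a) = k • star a) (k : K) (p : ℕ →₀ A) :
    betaMap (k • p) = k • betaMap p := by
  induction p using Finsupp.induction_linear with
  | zero => simp
  | add p q hp hq => simp [betaMap_add, hp, hq]
  | single i a =>
    by_cases h : Even i <;> simp [betaMap_single, starIter_eq_ite, Nat.even_add_one, h, hstar]

theorem betaMap_betaMap {A : Type*} [NonAssocRing A] [StarRing A] (p : ℕ →₀ A) :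
    betaMap (betaMap p) = p := by
  induction p using Finsupp.induction_linear with
  | zero => simp
  | add p q hp hq => simp [betaMap_add, hp, hq]
  | single i a => simp [betaMap_single, starIter_starIter]

theorem betaMap_fmul {A : Type*} [NonAssocRing A] [StarRing A] (p q : ℕ →₀ A) :
    betaMap (fmul p q) = fmul (betaMap q) (betaMap p) := by
  induction p using Finsupp.induction_linear with
  | zero => simp
  | add p p' hp hp' => simp [betaMap_add, fmul_add_left, fmul_add_right, hp, hp']
  | single m a =>
    induction q using Finsupp.induction_linear with
    | zero => simp
    | add q q' hq hq' => simp [betaMap_add, fmul_add_left, fmul_add_right, hq, hq']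
    | single n b =>
      simp only [betaMap_single, fmul_single_single, starIter_tau, add_comm n m]

/-- `β` is an involution of `B = A[X;*]^fl` extending the involution `*` of `A`:
it is `K`-linear, satisfies `β∘β = id` and `β(pq) = β(q)β(p)`, and restricts to `*` on `A`. -/
theorem betaMap_is_involution {K A : Type*} [CommRing K] [NonAssocRing A] [Module K A]
    [SMulCommClass K A A] [IsScalarTower K A A] [StarRing A]
    (hstar : ∀ (k : K) (a : A), star (k • a) = k • star a) :
    (∀ p q : ℕ →₀ A, betaMap (p + q) = betaMap p + betaMap q) ∧
    (∀ (k : K) (p : ℕ →₀ A), betaMap (k • p) = k • betaMap p) ∧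
    (∀ p : ℕ →₀ A, betaMap (betaMap p) = p) ∧
    (∀ p q : ℕ →₀ A, betaMap (fmul p q) = fmul (betaMap q) (betaMap p)) ∧
    (∀ a : A, betaMap (Finsupp.single 0 a) = Finsupp.single 0 (star a)) := by
  exact ⟨betaMap_add, betaMap_smul hstar, betaMap_betaMap, betaMap_fmul,
    fun a => by simp [betaMap_single, starIter]⟩
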